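/- Assume η_y > 0 for every y ∈ Fin K and that Condition 1 (Information Advantage of the Optimal Expert) holds with optimal expert j*. Then every minimizer q* of R_CE on Δ_{K+J} satisfies: (i) q*_y = η_y/(1 + V) for every y ∈ Fin K; (ii) q*_{⊥j*} > q*_{⊥j} for every expert j ≠ j*, i.e., the expert coordinates of q* have j* as their unique argmax; (iii) q*_{⊥j*} = Acc_{j*}/(1 + V); (iv) if Acc_{j*} > max_{y ∈ Fin K} η_y then q*_{⊥j*} > q*_c for every other coordinate c of q*, so the overall maximum coordinate is uniquely the j*-th expert coordinate (the system defers to the optimal expert); and if Acc_{j*} < max_{y ∈ Fin K} η_y then every coordinate of maximal q*-value is a class coordinate y with η_y = max_{y'} η_{y'} (the system predicts a Bayes-optimal class). Hence the argmax prediction link applied to any minimizer reproduces the Bayes-optimal learning-to-defer decision. -/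

import Mathlib

open Finset

noncomputable section

/-- `negLog x = -log x`, valued in `EReal`, with the convention `-log 0 = +∞`. -/
def negLog (x : ℝ) : EReal := if x = 0 then ⊤ else ((-Real.log x : ℝ) : EReal)

/-- The PiCCE cross-entropy conditional risk
`R_CE(q) = Σ_ω μ(ω)·[−log q_{Y ω} + (−log(max_{j ∈ S(ω)} q_{⊥j}) if S(ω) ≠ ∅ else 0)]`. -/
def RCE {K J : ℕ} {Ω : Type*} [Fintype Ω]
    (μ : Ω → ℝ) (Y : Ω → Fin K) (M : Fin J → Ω → Fin K)
    (q : Fin K ⊕ Fin J → ℝ) : EReal :=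
  ∑ ω, (μ ω : EReal) *
    (negLog (q (Sum.inl (Y ω))) +
      if h : (univ.filter (fun j => M j ω = Y ω)).Nonempty
      then negLog ((univ.filter (fun j => M j ω = Y ω)).sup' h (fun j => q (Sum.inr j)))
      else 0)

/-- The probability simplex on `Fin K ⊕ Fin J`. -/
def simplex (K J : ℕ) : Set (Fin K ⊕ Fin J → ℝ) :=
  {q | (∀ c, 0 ≤ q c) ∧ ∑ c, q c = 1}

/-- The largest value of `v` on `S`, with the convention that it is `1` when `S` is empty. -/
def maxOrOne {ι : Type*} (v : ι → ℝ) (S : Finset ι) : ℝ :=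
  if h : S.Nonempty then S.sup' h v else 1

theorem maxOrOne_empty {ι : Type*} (v : ι → ℝ) : maxOrOne v ∅ = 1 := by
  simp [maxOrOne]

theorem maxOrOne_eq {ι : Type*} {v : ι → ℝ} {S : Finset ι} {i : ι} (hi : i ∈ S)
    (h : ∀ k ∈ S, v k ≤ v i) : maxOrOne v S = v i := by
  rw [maxOrOne, dif_pos ⟨i, hi⟩]
  exact le_antisymm (sup'_le _ _ h) (le_sup' v hi)

theorem le_maxOrOne {ι : Type*} {v : ι → ℝ} {S : Finset ι} {i : ι} (hi : i ∈ S) :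
    v i ≤ maxOrOne v S := by
  rw [maxOrOne, dif_pos ⟨i, hi⟩]
  exact le_sup' v hi

theorem exists_maxOrOne_eq {ι : Type*} (v : ι → ℝ) {S : Finset ι} (hS : S.Nonempty) :
    ∃ i ∈ S, maxOrOne v S = v i ∧ ∀ k ∈ S, v k ≤ v i := by
  obtain ⟨i, hi, h⟩ := S.exists_max_image v hS
  exact ⟨i, hi, maxOrOne_eq hi h, h⟩

theorem maxOrOne_congr {ι : Type*} {v w : ι → ℝ} {S : Finset ι} (h : ∀ i ∈ S, v i = w i) :
    maxOrOne v S = maxOrOne w S := by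
  rcases S.eq_empty_or_nonempty with rfl | hS
  · simp [maxOrOne_empty]
  · obtain ⟨i, hi, he, hm⟩ := exists_maxOrOne_eq v hS
    rw [he, h i hi, maxOrOne_eq hi fun k hk => by rw [← h k hk, ← h i hi]; exact hm k hk]

theorem maxOrOne_div {ι : Type*} (v : ι → ℝ) {S : Finset ι} (hS : S.Nonempty) {T : ℝ}
    (hT : 0 < T) : maxOrOne (fun i => v i / T) S = maxOrOne v S / T := by
  obtain ⟨i, hi, he, hm⟩ := exists_maxOrOne_eq v hS
  rw [he, maxOrOne_eq hi fun k hk => by have := hm k hk; gcongr]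

theorem negLog_nonneg {x : ℝ} (h0 : 0 ≤ x) (h1 : x ≤ 1) : 0 ≤ negLog x := by
  unfold negLog
  split_ifs
  · exact le_top
  · exact_mod_cast neg_nonneg.2 (Real.log_nonpos h0 h1)

theorem negLog_of_pos {x : ℝ} (h : 0 < x) : negLog x = ((-Real.log x : ℝ) : EReal) :=
  if_neg h.ne'

theorem coe_sum_ereal {ι : Type*} (s : Finset ι) (f : ι → ℝ) :
    ((∑ i ∈ s, f i : ℝ) : EReal) = ∑ i ∈ s, (f i : EReal) :=
  map_sum (⟨⟨Real.toEReal, EReal.coe_zero⟩, EReal.coe_add⟩ : ℝ →+ EReal) f s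

section Risk

variable {K J : ℕ} {Ω : Type*}

/-- The experts that are correct at `ω`. -/
def correctExperts (Y : Ω → Fin K) (M : Fin J → Ω → Fin K) (ω : Ω) : Finset (Fin J) :=
  univ.filter (fun j => M j ω = Y ω)

theorem mem_correctExperts {Y : Ω → Fin K} {M : Fin J → Ω → Fin K} {ω : Ω} {j : Fin J} :
    j ∈ correctExperts Y M ω ↔ M j ω = Y ω := by
  simp [correctExperts]

variable [Fintype Ω]

/-- The log-likelihood `Σ_ω μ(ω) log p_{Y ω}` of the class coordinates. -/
def classLogLik (μ : Ω → ℝ) (Y : Ω → Fin K) (p : Fin K → ℝ) : ℝ :=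
  ∑ ω, μ ω * Real.log (p (Y ω))

/-- The log-likelihood of the best correct expert coordinate. -/
def expertLogLik (μ : Ω → ℝ) (Y : Ω → Fin K) (M : Fin J → Ω → Fin K) (v : Fin J → ℝ) : ℝ :=
  ∑ ω, μ ω * Real.log (maxOrOne v (correctExperts Y M ω))

theorem RCE_eq_sum (μ : Ω → ℝ) (Y : Ω → Fin K) (M : Fin J → Ω → Fin K)
    (q : Fin K ⊕ Fin J → ℝ) :
    RCE μ Y M q = ∑ ω, (μ ω : EReal) * (negLog (q (Sum.inl (Y ω))) +
      negLog (maxOrOne (fun j => q (Sum.inr j)) (correctExperts Y M ω))) := by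
  unfold RCE
  refine sum_congr rfl fun ω _ => ?_
  congr 2
  unfold maxOrOne correctExperts
  split_ifs
  · rfl
  · simp [negLog]

theorem RCE_eq_coe {μ : Ω → ℝ} (hμ : ∀ ω, 0 ≤ μ ω) (Y : Ω → Fin K) (M : Fin J → Ω → Fin K)
    (q : Fin K ⊕ Fin J → ℝ) (hp : ∀ ω, 0 < μ ω → 0 < q (Sum.inl (Y ω)))
    (hv : ∀ ω, 0 < μ ω → 0 < maxOrOne (fun j => q (Sum.inr j)) (correctExperts Y M ω)) :
    RCE μ Y M q = ((-(classLogLik μ Y (fun y => q (Sum.inl y)) +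
      expertLogLik μ Y M (fun j => q (Sum.inr j))) : ℝ) : EReal) := by
  rw [RCE_eq_sum, classLogLik, expertLogLik, ← sum_add_distrib, ← sum_neg_distrib]
  rw [coe_sum_ereal]
  refine sum_congr rfl fun ω _ => ?_
  rcases (hμ ω).eq_or_lt with h | h
  · simp [← h]
  · rw [negLog_of_pos (hp ω h), negLog_of_pos (hv ω h), ← EReal.coe_add, ← EReal.coe_mul]
    congr 1
    ring

theorem pos_of_RCE_ne_top {μ : Ω → ℝ} (hμ : ∀ ω, 0 ≤ μ ω) {Y : Ω → Fin K}
    {M : Fin J → Ω → Fin K} {q : Fin K ⊕ Fin J → ℝ} (hq : q ∈ simplex K J)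
    (hfin : RCE μ Y M q ≠ ⊤) {ω : Ω} (hω : 0 < μ ω) :
    0 < q (Sum.inl (Y ω)) ∧
      0 < maxOrOne (fun j => q (Sum.inr j)) (correctExperts Y M ω) := by
  have hle : ∀ c, q c ≤ 1 := fun c => by
    rw [← hq.2]
    exact single_le_sum (fun c _ => hq.1 c) (mem_univ c)
  have hbest : ∀ ω, 0 ≤ maxOrOne (fun j => q (Sum.inr j)) (correctExperts Y M ω) ∧
      maxOrOne (fun j => q (Sum.inr j)) (correctExperts Y M ω) ≤ 1 := fun ω => by
    rcases (correctExperts Y M ω).eq_empty_or_nonempty with h | h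
    · simp [h, maxOrOne_empty]
    · obtain ⟨i, -, he, -⟩ := exists_maxOrOne_eq (fun j => q (Sum.inr j)) h
      rw [he]
      exact ⟨hq.1 _, hle _⟩
  have hA : ∀ ω, 0 ≤ negLog (q (Sum.inl (Y ω))) := fun ω => negLog_nonneg (hq.1 _) (hle _)
  have hB : ∀ ω, 0 ≤ negLog (maxOrOne (fun j => q (Sum.inr j)) (correctExperts Y M ω)) :=
    fun ω => negLog_nonneg (hbest ω).1 (hbest ω).2
  by_contra hcon
  apply hfin
  rw [RCE_eq_sum, eq_top_iff]
  refine le_trans ?_ (single_le_sum (fun ω _ => mul_nonneg (EReal.coe_nonneg.2 (hμ ω))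
    (add_nonneg (hA ω) (hB ω))) (mem_univ ω))
  have htop : negLog (q (Sum.inl (Y ω))) +
      negLog (maxOrOne (fun j => q (Sum.inr j)) (correctExperts Y M ω)) = ⊤ := by
    rw [eq_top_iff]
    by_cases h : q (Sum.inl (Y ω)) = 0
    · have : negLog (q (Sum.inl (Y ω))) = ⊤ := if_pos h
      exact this ▸ le_add_of_nonneg_right (hB ω)
    · have h' : maxOrOne (fun j => q (Sum.inr j)) (correctExperts Y M ω) = 0 := by
        by_contra h2
        exact hcon ⟨(hq.1 _).lt_of_ne' h, (hbest ω).1.lt_of_ne' h2⟩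
      have : negLog (maxOrOne (fun j => q (Sum.inr j)) (correctExperts Y M ω)) = ⊤ := if_pos h'
      exact this ▸ le_add_of_nonneg_left (hA ω)
  rw [htop, EReal.coe_mul_top_of_pos hω]

/-- Homogeneous form of minimality: normalising a nonnegative vector of total mass `T` costs
`(1 + V) log T` of log-likelihood. -/
theorem logLik_sub_le_of_isMin {μ : Ω → ℝ} (hμ : ∀ ω, 0 ≤ μ ω) (hsum : ∑ ω, μ ω = 1)
    {Y : Ω → Fin K} {M : Fin J → Ω → Fin K} {V : ℝ}
    (hV : V = ∑ ω ∈ univ.filter (fun ω => ∃ j : Fin J, M j ω = Y ω), μ ω)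
    {q : Fin K ⊕ Fin J → ℝ} (hmin : ∀ q' ∈ simplex K J, RCE μ Y M q ≤ RCE μ Y M q')
    (hqp : ∀ ω, 0 < μ ω → 0 < q (Sum.inl (Y ω)))
    (hqv : ∀ ω, 0 < μ ω → 0 < maxOrOne (fun j => q (Sum.inr j)) (correctExperts Y M ω))
    {p : Fin K → ℝ} {v : Fin J → ℝ} (hp0 : ∀ y, 0 ≤ p y) (hv0 : ∀ j, 0 ≤ v j)
    (hp : ∀ ω, 0 < μ ω → 0 < p (Y ω))
    (hv : ∀ ω, 0 < μ ω → 0 < maxOrOne v (correctExperts Y M ω)) :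
    classLogLik μ Y p + expertLogLik μ Y M v - (1 + V) * Real.log (∑ y, p y + ∑ j, v j) ≤
      classLogLik μ Y (fun y => q (Sum.inl y)) + expertLogLik μ Y M (fun j => q (Sum.inr j)) := by
  obtain ⟨ω₀, hω₀⟩ : ∃ ω, 0 < μ ω := by
    by_contra! h
    have := sum_nonpos fun ω (_ : ω ∈ univ) => h ω
    linarith
  set T := ∑ y, p y + ∑ j, v j with hTdef
  have hT : 0 < T := by
    have h1 : p (Y ω₀) ≤ ∑ y, p y := single_le_sum (fun y _ => hp0 y) (mem_univ _)
    have h2 : 0 ≤ ∑ j, v j := sum_nonneg fun j _ => hv0 j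
    have h3 := hp ω₀ hω₀
    linarith
  have hv' : ∀ ω, 0 < μ ω → 0 < maxOrOne (fun j => v j / T) (correctExperts Y M ω) :=
    fun ω hω => by
      rcases (correctExperts Y M ω).eq_empty_or_nonempty with h | h
      · simp [h, maxOrOne_empty]
      · rw [maxOrOne_div v h hT]
        exact div_pos (hv ω hω) hT
  have hmem : Sum.elim (fun y => p y / T) (fun j => v j / T) ∈ simplex K J := by
    refine ⟨?_, ?_⟩
    · rintro (y | j)
      · exact div_nonneg (hp0 y) hT.le
      · exact div_nonneg (hv0 j) hT.le
    · simp only [Fintype.sum_sum_type, Sum.elim_inl, Sum.elim_inr, ← sum_div]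
      rw [← add_div, ← hTdef, div_self hT.ne']
  have key := hmin _ hmem
  rw [RCE_eq_coe hμ Y M q hqp hqv, RCE_eq_coe hμ Y M _
    (fun ω hω => by simpa using div_pos (hp ω hω) hT) (by simpa using hv'),
    EReal.coe_le_coe_iff] at key
  simp only [Sum.elim_inl, Sum.elim_inr] at key
  have e1 : classLogLik μ Y (fun y => p y / T) = classLogLik μ Y p - Real.log T := by
    have : Real.log T = ∑ ω, μ ω * Real.log T := by rw [← sum_mul, hsum, one_mul]
    rw [this, classLogLik, classLogLik, ← sum_sub_distrib]
    refine sum_congr rfl fun ω _ => ?_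
    rcases (hμ ω).eq_or_lt with h | h
    · simp [← h]
    · rw [Real.log_div (hp ω h).ne' hT.ne']
      ring
  have e2 : expertLogLik μ Y M (fun j => v j / T) = expertLogLik μ Y M v - V * Real.log T := by
    rw [hV, sum_mul, sum_filter, expertLogLik, expertLogLik, ← sum_sub_distrib]
    refine sum_congr rfl fun ω _ => ?_
    rcases (hμ ω).eq_or_lt with h | h
    · simp [← h]
    · split_ifs with hj
      · obtain ⟨j, hj⟩ := hj
        rw [maxOrOne_div v ⟨j, mem_correctExperts.2 hj⟩ hT, Real.log_div (hv ω h).ne' hT.ne']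
        ring
      · have : correctExperts Y M ω = ∅ :=
          eq_empty_of_forall_notMem fun j hm => hj ⟨j, mem_correctExperts.1 hm⟩
        simp [this, maxOrOne_empty]
  rw [e1, e2] at key
  linarith

end Risk

theorem eq_mul_of_eventually_mul_log_le {a b x : ℝ}
    (h : ∀ᶠ s in nhds (0 : ℝ), a * Real.log (1 + s) ≤ b * Real.log (1 + s * x)) : a = b * x := by
  have hd : HasDerivAt (fun s : ℝ => a * Real.log (1 + s) - b * Real.log (1 + s * x))
      (a - b * x) 0 := by
    have h1 : HasDerivAt (fun s : ℝ => 1 + s) 1 0 := (hasDerivAt_id 0).const_add 1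
    have h2 : HasDerivAt (fun s : ℝ => 1 + s * x) x 0 := by
      simpa using ((hasDerivAt_id (0 : ℝ)).mul_const x).const_add 1
    simpa using ((h1.log (by simp)).const_mul a).fun_sub ((h2.log (by simp)).const_mul b)
  have hmax : IsLocalMax (fun s : ℝ => a * Real.log (1 + s) - b * Real.log (1 + s * x)) 0 := by
    filter_upwards [h] with s hs
    simpa using hs
  linarith [hmax.hasDerivAt_eq_zero hd]

theorem exists_mul_log_add_mul_log_pos {a b : ℝ} (hb : 0 ≤ b) (hab : b < a) :
    ∃ x : ℝ, 0 < x ∧ x < 1 ∧ 0 < a * Real.log (1 + x) + b * Real.log (1 - x) := by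
  have hs : 0 < a + b := by linarith
  have hx0 : 0 < (a - b) / (2 * (a + b)) := by apply div_pos <;> linarith
  have hx1 : (a - b) / (2 * (a + b)) < 1 := by rw [div_lt_one (by linarith)]; linarith
  have hx : (a - b) / (2 * (a + b)) * (2 * (a + b)) = a - b := by field_simp
  refine ⟨_, hx0, hx1, ?_⟩
  generalize (a - b) / (2 * (a + b)) = x at *
  have h1 := Real.one_sub_inv_le_log_of_pos (show 0 < 1 + x by linarith)
  have h2 := Real.one_sub_inv_le_log_of_pos (show 0 < 1 - x by linarith)
  have h3 := mul_le_mul_of_nonneg_left h1 (show 0 ≤ a by linarith)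
  have h4 := mul_le_mul_of_nonneg_left h2 hb
  have h5 : 0 < a * (1 - (1 + x)⁻¹) + b * (1 - (1 - x)⁻¹) := by
    have hp : 0 < 1 + x := by linarith
    have hm : 0 < 1 - x := by linarith
    have : a * (1 - (1 + x)⁻¹) + b * (1 - (1 - x)⁻¹) =
        x * (a * (1 - x) - b * (1 + x)) / ((1 + x) * (1 - x)) := by
      field_simp
      ring
    rw [this]
    apply div_pos (mul_pos hx0 _) (mul_pos hp hm)
    nlinarith
  linarith

section Perturb

variable {K J : ℕ} {Ω : Type*} [Fintype Ω] {μ : Ω → ℝ} {Y : Ω → Fin K} {M : Fin J → Ω → Fin K}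

theorem classLogLik_update (hμ : ∀ ω, 0 ≤ μ ω) {p : Fin K → ℝ}
    (hp : ∀ ω, 0 < μ ω → 0 < p (Y ω)) (y : Fin K) {s : ℝ} (hs : 0 < 1 + s) :
    classLogLik μ Y (Function.update p y ((1 + s) * p y)) =
      classLogLik μ Y p + (∑ ω ∈ univ.filter (fun ω => Y ω = y), μ ω) * Real.log (1 + s) := by
  rw [sum_mul, sum_filter, classLogLik, classLogLik, ← sum_add_distrib]
  refine sum_congr rfl fun ω _ => ?_
  rcases (hμ ω).eq_or_lt with h | h
  · simp [← h]
  · split_ifs with hy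
    · have := hp ω h
      rw [hy] at this ⊢
      rw [Function.update_self, Real.log_mul hs.ne' this.ne']
      ring
    · rw [Function.update_of_ne hy, add_zero]

theorem sum_update_one_add_mul {ι : Type*} [Fintype ι] [DecidableEq ι] (p : ι → ℝ) (y : ι)
    (s : ℝ) : ∑ i, Function.update p y ((1 + s) * p y) i = ∑ i, p i + s * p y := by
  rw [sum_update_of_mem (mem_univ y), ← add_sum_erase univ p (mem_univ y), sdiff_singleton_eq_erase]
  ring

/-- Rescaling a strictly dominant expert coordinate. -/
theorem maxOrOne_update {v : Fin J → ℝ} {j₀ : Fin J} {t : ℝ} (hmax : ∀ j ≠ j₀, v j ≤ v j₀)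
    (ht : ∀ j ≠ j₀, v j ≤ t) (S : Finset (Fin J)) :
    (j₀ ∈ S → maxOrOne (Function.update v j₀ t) S = t ∧ maxOrOne v S = v j₀) ∧
      (j₀ ∉ S → maxOrOne (Function.update v j₀ t) S = maxOrOne v S) := by
  refine ⟨fun h => ⟨?_, ?_⟩, fun h => ?_⟩
  · rw [maxOrOne_eq h, Function.update_self]
    intro k _
    by_cases hk : k = j₀
    · rw [hk]
    · rw [Function.update_of_ne hk, Function.update_self]
      exact ht k hk
  · refine maxOrOne_eq h fun k _ => ?_
    by_cases hk : k = j₀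
    · rw [hk]
    · exact hmax k hk
  · exact maxOrOne_congr fun i hi => Function.update_of_ne (ne_of_mem_of_not_mem hi h) _ _

theorem expertLogLik_update {v : Fin J → ℝ} {j₀ : Fin J} {s : ℝ} (hmax : ∀ j ≠ j₀, v j ≤ v j₀)
    (hs : 0 < 1 + s) (hpos : 0 < v j₀) (ht : ∀ j ≠ j₀, v j ≤ (1 + s) * v j₀) :
    expertLogLik μ Y M (Function.update v j₀ ((1 + s) * v j₀)) =
      expertLogLik μ Y M v +
        (∑ ω ∈ univ.filter (fun ω => M j₀ ω = Y ω), μ ω) * Real.log (1 + s) := by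
  rw [sum_mul, sum_filter, expertLogLik, expertLogLik, ← sum_add_distrib]
  refine sum_congr rfl fun ω _ => ?_
  have h := maxOrOne_update hmax ht (correctExperts Y M ω)
  rw [mem_correctExperts] at h
  split_ifs with hc
  · rw [(h.1 hc).1, (h.1 hc).2, Real.log_mul hs.ne' hpos.ne']
    ring
  · rw [h.2 hc, add_zero]

/-- Swapping the coordinate of `j₀` with the next larger one, held by `j`. -/
theorem log_maxOrOne_swap {v : Fin J → ℝ} {j j₀ : Fin J} (hlt : v j₀ < v j)
    (hnext : ∀ k, v j₀ < v k → v j ≤ v k) (S : Finset (Fin J)) :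
    Real.log (maxOrOne (v ∘ Equiv.swap j j₀) S) = Real.log (maxOrOne v S) +
      (Real.log (v j) - Real.log (v j₀)) *
        ((if ∃ i ∈ insert j₀ ((univ.filter fun i => v j₀ < v i).erase j), i ∈ S then 1 else 0) -
          (if ∃ i ∈ insert j ((univ.filter fun i => v j₀ < v i).erase j), i ∈ S then 1 else 0)) := by
  have hne : j ≠ j₀ := fun e => hlt.ne (by rw [e])
  have hj₀ : (v ∘ Equiv.swap j j₀) j₀ = v j := by simp
  have hj : (v ∘ Equiv.swap j j₀) j = v j₀ := by simp
  have hk : ∀ k, k ≠ j → k ≠ j₀ → (v ∘ Equiv.swap j j₀) k = v k := fun k h1 h2 => by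
    simp [Equiv.swap_apply_of_ne_of_ne h1 h2]
  have hval : ∀ k, (v ∘ Equiv.swap j j₀) k =
      if k = j then v j₀ else if k = j₀ then v j else v k := fun k => by
    split_ifs with h1 h2
    · rw [h1, hj]
    · rw [h2, hj₀]
    · exact hk k h1 h2
  generalize v ∘ Equiv.swap j j₀ = w at *
  by_cases hU : ∃ i ∈ (univ.filter fun i => v j₀ < v i).erase j, i ∈ S
  · have h1 : ∃ i ∈ insert j₀ ((univ.filter fun i => v j₀ < v i).erase j), i ∈ S := by
      obtain ⟨i, hi, hS⟩ := hU
      exact ⟨i, mem_insert_of_mem hi, hS⟩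
    have h2 : ∃ i ∈ insert j ((univ.filter fun i => v j₀ < v i).erase j), i ∈ S := by
      obtain ⟨i, hi, hS⟩ := hU
      exact ⟨i, mem_insert_of_mem hi, hS⟩
    rw [if_pos h1, if_pos h2, sub_self, mul_zero, add_zero]
    obtain ⟨i, hi, hS⟩ := hU
    obtain ⟨m, hm, hmm⟩ := exists_max_image (S.filter fun i => i ≠ j ∧ v j₀ < v i) v
      ⟨i, by simp at hi; simp [hi, hS]⟩
    simp only [mem_filter] at hm hmm
    obtain ⟨hmS, hmj, hmv⟩ := hm
    have hbm : v j ≤ v m := hnext m hmv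
    have hmj₀ : m ≠ j₀ := fun e => hmv.ne (by rw [e])
    have hle : ∀ k ∈ S, v k ≤ v m := fun k hk' => by
      by_cases e : k = j
      · rw [e]; exact hbm
      · by_cases e' : v j₀ < v k
        · exact hmm k ⟨hk', e, e'⟩
        · linarith
    rw [maxOrOne_eq hmS hle, maxOrOne_eq (v := w) hmS, hk m hmj hmj₀]
    intro k hk'
    rw [hk m hmj hmj₀, hval k]
    split_ifs
    · exact hmv.le
    · exact hbm
    · exact hle k hk'
  · have hsmall : ∀ k ∈ S, k ≠ j → v k ≤ v j₀ := fun k hkS hkj => by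
      by_contra! h
      exact hU ⟨k, by simp [hkj, h], hkS⟩
    have h1 : (∃ i ∈ insert j₀ ((univ.filter fun i => v j₀ < v i).erase j), i ∈ S) ↔ j₀ ∈ S := by
      rw [exists_mem_insert]
      exact or_iff_left hU
    have h2 : (∃ i ∈ insert j ((univ.filter fun i => v j₀ < v i).erase j), i ∈ S) ↔ j ∈ S := by
      rw [exists_mem_insert]
      exact or_iff_left hU
    simp only [h1, h2]
    have hvj : j ∈ S → maxOrOne v S = v j := fun h => maxOrOne_eq h fun k hkS => by
      by_cases e : k = j
      · rw [e]
      · exact (hsmall k hkS e).trans hlt.le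
    have hwj : j₀ ∈ S → maxOrOne w S = v j := fun h => by
      rw [maxOrOne_eq h, hj₀]
      intro k hkS
      rw [hj₀, hval k]
      split_ifs with e
      · exact hlt.le
      · exact le_rfl
      · exact (hsmall k hkS e).trans hlt.le
    have hvj₀ : j ∉ S → j₀ ∈ S → maxOrOne v S = v j₀ := fun h h' => maxOrOne_eq h' fun k hkS =>
      hsmall k hkS fun e => h (e ▸ hkS)
    have hwj₀ : j ∈ S → j₀ ∉ S → maxOrOne w S = v j₀ := fun h h' => by
      rw [maxOrOne_eq h, hj]
      intro k hkS
      rw [hj, hval k]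
      split_ifs with e e'
      · exact le_rfl
      · exact absurd (e' ▸ hkS) h'
      · exact hsmall k hkS e
    by_cases hjS : j ∈ S <;> by_cases hj₀S : j₀ ∈ S
    · simp [hjS, hj₀S, hvj hjS, hwj hj₀S]
    · simp [hjS, hj₀S, hvj hjS, hwj₀ hjS hj₀S]
    · simp [hjS, hj₀S, hvj₀ hjS hj₀S, hwj hj₀S]
    · simp only [hjS, hj₀S, if_false, sub_self, mul_zero, add_zero]
      rw [maxOrOne_congr fun i hi => hk i (fun e => hjS (e ▸ hi)) fun e => hj₀S (e ▸ hi)]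

theorem maxOrOne_swap_pos {v : Fin J → ℝ} {j j₀ : Fin J} (h₀ : 0 < v j₀) (hj : 0 < v j)
    {S : Finset (Fin J)} (hS : 0 < maxOrOne v S) : 0 < maxOrOne (v ∘ Equiv.swap j j₀) S := by
  rcases S.eq_empty_or_nonempty with rfl | hne
  · simp [maxOrOne_empty]
  · obtain ⟨i, hi, he, -⟩ := exists_maxOrOne_eq v hne
    refine lt_of_lt_of_le ?_ (le_maxOrOne hi)
    rw [he] at hS
    rw [Function.comp_apply, Equiv.swap_apply_def]
    split_ifs <;> assumption

/-- Moving mass `x * v j₀` between two tied maximal coordinates. -/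
theorem log_maxOrOne_transfer {v : Fin J → ℝ} {j j₀ : Fin J} (hne : j ≠ j₀)
    (hmax : ∀ k, v k ≤ v j₀) (heq : v j = v j₀) (hpos : 0 < v j₀) {x : ℝ} (hx0 : 0 < x)
    (hx1 : x < 1) {S : Finset (Fin J)} (hS : 0 < maxOrOne v S) :
    0 < maxOrOne (Function.update (Function.update v j₀ ((1 + x) * v j₀)) j ((1 - x) * v j₀)) S ∧
    Real.log (maxOrOne v S) + (if j₀ ∈ S then Real.log (1 + x) else 0) +
      (if j ∈ S then Real.log (1 - x) else 0) ≤ Real.log (maxOrOne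
        (Function.update (Function.update v j₀ ((1 + x) * v j₀)) j ((1 - x) * v j₀)) S) := by
  set w := Function.update (Function.update v j₀ ((1 + x) * v j₀)) j ((1 - x) * v j₀) with hw
  have hwj : w j = (1 - x) * v j₀ := by simp [hw]
  have hwj₀ : w j₀ = (1 + x) * v j₀ := by simp [hw, Function.update_of_ne hne.symm]
  have hwk : ∀ k, k ≠ j → k ≠ j₀ → w k = v k := fun k h1 h2 => by
    simp [hw, Function.update_of_ne h1, Function.update_of_ne h2]
  have hneg : Real.log (1 - x) ≤ 0 := Real.log_nonpos (by linarith) (by linarith)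
  have h1x : 0 < (1 - x) * v j₀ := mul_pos (by linarith) hpos
  have h2x : 0 < (1 + x) * v j₀ := mul_pos (by linarith) hpos
  by_cases h0 : j₀ ∈ S
  · have hle := le_maxOrOne (v := w) h0
    rw [hwj₀] at hle
    refine ⟨h2x.trans_le hle, ?_⟩
    have := Real.log_le_log h2x hle
    rw [Real.log_mul (by linarith) hpos.ne'] at this
    rw [maxOrOne_eq h0 fun k _ => hmax k, if_pos h0]
    split_ifs <;> linarith
  · by_cases hj : j ∈ S
    · have hle := le_maxOrOne (v := w) hj
      rw [hwj] at hle
      refine ⟨h1x.trans_le hle, ?_⟩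
      have := Real.log_le_log h1x hle
      rw [Real.log_mul (by linarith) hpos.ne'] at this
      rw [maxOrOne_eq hj fun k _ => heq ▸ hmax k, if_neg h0, if_pos hj, heq]
      linarith
    · rw [maxOrOne_congr fun i hi => hwk i (fun e => hj (e ▸ hi)) fun e => h0 (e ▸ hi)]
      simp [h0, hj, hS]

theorem sum_transfer {v : Fin J → ℝ} {j j₀ : Fin J} (hne : j ≠ j₀) (heq : v j = v j₀) (x : ℝ) :
    ∑ i, Function.update (Function.update v j₀ ((1 + x) * v j₀)) j ((1 - x) * v j₀) i =
      ∑ i, v i := by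
  have h := sum_update_one_add_mul (Function.update v j₀ ((1 + x) * v j₀)) j (-x)
  rw [sum_update_one_add_mul v, Function.update_of_ne hne, heq, show 1 + -x = 1 - x by ring] at h
  linarith

end Perturb

/-- Consistency of PiCCE-CE: under positivity of the class probabilities
and Condition 1 (Information Advantage of the Optimal Expert `j*`), every minimizer `q*`
of `R_CE` on the simplex satisfies: (i) `q*_y = η_y/(1+V)` for every class `y`;
(ii) `j*` is the unique argmax of the expert coordinates; (iii) `q*_{⊥j*} = Acc_{j*}/(1+V)`;
(iv) if `Acc_{j*} > max_y η_y` the overall argmax coordinate is uniquely `⊥j*`, and if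
`Acc_{j*} < max_y η_y` every maximal coordinate is a class coordinate with maximal `η`. -/
theorem stmt11
    {K J : ℕ} (hK : 0 < K) (hJ : 0 < J)
    {Ω : Type*} [Fintype Ω] [Nonempty Ω]
    (μ : Ω → ℝ) (hμ : ∀ ω, 0 ≤ μ ω) (hsum : ∑ ω, μ ω = 1)
    (Y : Ω → Fin K) (M : Fin J → Ω → Fin K)
    (η : Fin K → ℝ) (hη : ∀ y, η y = ∑ ω ∈ univ.filter (fun ω => Y ω = y), μ ω)
    (Acc : Fin J → ℝ)
    (hAcc : ∀ j, Acc j = ∑ ω ∈ univ.filter (fun ω => M j ω = Y ω), μ ω)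
    (V : ℝ) (hV : V = ∑ ω ∈ univ.filter (fun ω => ∃ j : Fin J, M j ω = Y ω), μ ω)
    (hηpos : ∀ y : Fin K, 0 < η y)
    (jstar : Fin J)
    (hdom : ∀ j : Fin J, j ≠ jstar → Acc j < Acc jstar)
    (hinfo : ∀ j : Fin J, j ≠ jstar → ∀ M' : Finset (Fin J), j ∉ M' → jstar ∉ M' →
      ∑ ω ∈ univ.filter (fun ω => ∃ i ∈ insert j M', M i ω = Y ω), μ ω <
      ∑ ω ∈ univ.filter (fun ω => ∃ i ∈ insert jstar M', M i ω = Y ω), μ ω) :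
    ∀ q ∈ simplex K J, (∀ q' ∈ simplex K J, RCE μ Y M q ≤ RCE μ Y M q') →
      (∀ y : Fin K, q (Sum.inl y) = η y / (1 + V)) ∧
      (∀ j : Fin J, j ≠ jstar → q (Sum.inr j) < q (Sum.inr jstar)) ∧
      (q (Sum.inr jstar) = Acc jstar / (1 + V)) ∧
      ((∀ y : Fin K, η y < Acc jstar) →
        ∀ c : Fin K ⊕ Fin J, c ≠ Sum.inr jstar → q c < q (Sum.inr jstar)) ∧
      ((∃ y : Fin K, Acc jstar < η y) →
        ∀ c : Fin K ⊕ Fin J, (∀ c' : Fin K ⊕ Fin J, q c' ≤ q c) →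
          ∃ y : Fin K, c = Sum.inl y ∧ ∀ y' : Fin K, η y' ≤ η y) := by
  intro q hq hmin
  have hfin : RCE μ Y M q ≠ ⊤ := by
    have hN : (0 : ℝ) < K + J := by positivity
    have hu : ∀ S : Finset (Fin J), 0 < maxOrOne (fun _ => (1 : ℝ) / (K + J)) S := fun S => by
      rcases S.eq_empty_or_nonempty with rfl | hS
      · simp [maxOrOne_empty]
      · obtain ⟨i, -, he, -⟩ := exists_maxOrOne_eq (fun _ => (1 : ℝ) / (K + J)) hS
        rw [he]
        positivity
    have hmem : (fun _ => (1 : ℝ) / (K + J)) ∈ simplex K J := by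
      refine ⟨fun _ => by positivity, ?_⟩
      simp only [sum_const, card_univ, Fintype.card_sum, Fintype.card_fin, nsmul_eq_mul]
      push_cast
      field_simp
    have h := hmin _ hmem
    rw [RCE_eq_coe hμ Y M (fun _ => (1 : ℝ) / (K + J)) (fun _ _ => one_div_pos.2 hN) (fun ω _ => hu _)] at h
    exact (h.trans_lt (EReal.coe_lt_top _)).ne
  have hqp := fun ω hω => (pos_of_RCE_ne_top hμ hq hfin (ω := ω) hω).1
  have hqv := fun ω hω => (pos_of_RCE_ne_top hμ hq hfin (ω := ω) hω).2
  have hcmp := fun p v => logLik_sub_le_of_isMin (p := p) (v := v) hμ hsum hV hmin hqp hqv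
  have hp0 : ∀ y, 0 ≤ q (Sum.inl y) := fun y => hq.1 _
  have hv0 : ∀ j, 0 ≤ q (Sum.inr j) := fun j => hq.1 _
  have hone : ∑ y, q (Sum.inl y) + ∑ j, q (Sum.inr j) = 1 := by
    rw [← Fintype.sum_sum_type]
    exact hq.2
  generalize hpdef : (fun y => q (Sum.inl y)) = p at *
  generalize hvdef : (fun j => q (Sum.inr j)) = v at *
  have ep : ∀ y, q (Sum.inl y) = p y := fun y => by rw [← hpdef]
  have ev : ∀ j, q (Sum.inr j) = v j := fun j => by rw [← hvdef]
  simp only [ep, ev] at hqp hp0 hv0 hone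
  have hV0 : 0 < 1 + V := by
    have : 0 ≤ V := hV ▸ sum_nonneg fun ω _ => hμ ω
    linarith
  have hs1 : ∀ᶠ s : ℝ in nhds 0, 0 < 1 + s := by
    filter_upwards [lt_mem_nhds (show (-1 : ℝ) < 0 by norm_num)] with s hs
    linarith
  have hclass : ∀ y, p y = η y / (1 + V) := fun y => by
    rw [eq_div_iff hV0.ne', mul_comm]
    refine (eq_mul_of_eventually_mul_log_le ?_).symm
    filter_upwards [hs1] with s hs
    have h := hcmp (Function.update p y ((1 + s) * p y)) v (fun y' => ?_) hv0 (fun ω hω => ?_) hqv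
    · rw [classLogLik_update hμ hqp y hs, ← hη, sum_update_one_add_mul] at h
      rw [show 1 + s * p y = ∑ i, p i + s * p y + ∑ j, v j by linarith]
      linarith
    · rw [Function.update_apply]
      split_ifs
      · exact mul_nonneg hs.le (hp0 y)
      · exact hp0 y'
    · rw [Function.update_apply]
      split_ifs with e
      · exact mul_pos hs (e ▸ hqp ω hω)
      · exact hqp ω hω
  have hcmp' : ∀ w : Fin J → ℝ, (∀ j, 0 ≤ w j) → ∑ j, w j = ∑ j, v j →
      (∀ ω, 0 < μ ω → 0 < maxOrOne w (correctExperts Y M ω)) →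
      expertLogLik μ Y M w ≤ expertLogLik μ Y M v := fun w hw hwsum hwpos => by
    have h := hcmp p w hp0 hw hqp hwpos
    rw [hwsum, hone, Real.log_one] at h
    linarith
  have hexists : 0 < Acc jstar → ∃ ω, 0 < μ ω ∧ M jstar ω = Y ω := fun h => by
    rw [hAcc] at h
    by_contra! hcon
    refine h.not_ge (sum_nonpos fun ω hω => ?_)
    by_contra! hω'
    exact hcon ω hω' (by simpa using hω)
  have hAcc0 : ∀ j, 0 ≤ Acc j := fun j => by
    rw [hAcc]
    exact sum_nonneg fun ω _ => hμ ω
  have hge : ∀ j, v j ≤ v jstar := by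
    by_contra! hex
    obtain ⟨j₁, hj₁⟩ := hex
    obtain ⟨j, hj, hjmin⟩ := exists_min_image (univ.filter fun k => v jstar < v k) v
      ⟨j₁, by simpa using hj₁⟩
    simp only [mem_filter, mem_univ, true_and] at hj hjmin
    have hne : j ≠ jstar := fun e => hj.ne (by rw [e])
    have hI := hinfo j hne ((univ.filter fun i => v jstar < v i).erase j) (by simp)
      (by simp)
    have hpos : 0 < v jstar := by
      by_contra! h0
      refine hI.not_ge ?_
      rw [sum_filter, sum_filter]
      refine sum_le_sum fun ω _ => ?_
      rcases (hμ ω).eq_or_lt with hω | hω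
      · simp [← hω]
      split_ifs with h1 h2
      · exact le_rfl
      · exfalso
        obtain ⟨i₁, hi₁, hc₁⟩ := h1
        obtain ⟨i, hi, he, -⟩ := exists_maxOrOne_eq v ⟨i₁, mem_correctExperts.2 hc₁⟩
        have hvi : 0 < v i := he ▸ hqv ω hω
        refine h2 ⟨i, ?_, mem_correctExperts.1 hi⟩
        by_cases e : i = j
        · simp [e]
        · simp [e, h0.trans_lt hvi]
      · exact hω.le
      · exact le_rfl
    have heq : expertLogLik μ Y M (v ∘ Equiv.swap j jstar) = expertLogLik μ Y M v +
        (Real.log (v j) - Real.log (v jstar)) *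
          (∑ ω ∈ univ.filter (fun ω => ∃ i ∈ insert jstar
              ((univ.filter fun i => v jstar < v i).erase j), M i ω = Y ω), μ ω -
            ∑ ω ∈ univ.filter (fun ω => ∃ i ∈ insert j
              ((univ.filter fun i => v jstar < v i).erase j), M i ω = Y ω), μ ω) := by
      rw [sum_filter, sum_filter, ← sum_sub_distrib, mul_sum, expertLogLik, expertLogLik,
        ← sum_add_distrib]
      refine sum_congr rfl fun ω _ => ?_
      rw [log_maxOrOne_swap hj hjmin]
      simp only [mem_correctExperts]
      split_ifs <;> ring
    have hle := hcmp' (v ∘ Equiv.swap j jstar) (fun k => hv0 _) (Equiv.sum_comp _ v)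
      fun ω hω => maxOrOne_swap_pos hpos (hpos.trans hj) (hqv ω hω)
    have := mul_pos (sub_pos.2 (Real.log_lt_log hpos hj)) (sub_pos.2 hI)
    linarith
  have hpos : 0 < Acc jstar → 0 < v jstar := fun h => by
    obtain ⟨ω, hω, hc⟩ := hexists h
    rw [← maxOrOne_eq (mem_correctExperts.2 hc) fun k _ => hge k]
    exact hqv ω hω
  have hgt : ∀ j, j ≠ jstar → v j < v jstar := fun j hne => by
    refine (hge j).lt_of_ne fun heq => ?_
    obtain ⟨x, hx0, hx1, hx⟩ := exists_mul_log_add_mul_log_pos (hAcc0 j) (hdom j hne)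
    have hvpos := hpos ((hAcc0 j).trans_lt (hdom j hne))
    have hT := fun ω hω => log_maxOrOne_transfer hne hge heq hvpos hx0 hx1 (hqv ω hω)
    have hle := hcmp' _ (fun k => ?_) (sum_transfer hne heq x) fun ω hω => (hT ω hω).1
    · have hlow : expertLogLik μ Y M v +
          (Acc jstar * Real.log (1 + x) + Acc j * Real.log (1 - x)) ≤ expertLogLik μ Y M
          (Function.update (Function.update v jstar ((1 + x) * v jstar)) j
            ((1 - x) * v jstar)) := by
        rw [hAcc, hAcc, sum_mul, sum_mul, sum_filter, sum_filter, expertLogLik, expertLogLik,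
          ← sum_add_distrib, ← sum_add_distrib]
        refine sum_le_sum fun ω _ => ?_
        rcases (hμ ω).eq_or_lt with hω | hω
        · simp [← hω]
        · have h := mul_le_mul_of_nonneg_left (hT ω hω).2 hω.le
          simp only [mem_correctExperts] at h
          refine le_trans (le_of_eq ?_) h
          split_ifs <;> ring
      linarith
    · rw [Function.update_apply, Function.update_apply]
      split_ifs
      · exact mul_nonneg (by linarith) hvpos.le
      · exact mul_nonneg (by linarith) hvpos.le
      · exact hv0 k
  have hstar : v jstar = Acc jstar / (1 + V) := by
    rcases (hv0 jstar).eq_or_lt with h0 | h0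
    · have : Acc jstar = 0 := le_antisymm (not_lt.1 fun h => (hpos h).ne h0) (hAcc0 _)
      rw [this, ← h0, zero_div]
    rw [eq_div_iff hV0.ne', mul_comm]
    refine (eq_mul_of_eventually_mul_log_le ?_).symm
    have hdomin : ∀ᶠ s : ℝ in nhds 0, ∀ j, j ≠ jstar → v j < (1 + s) * v jstar := by
      rw [Filter.eventually_all]
      intro j
      by_cases hj : j = jstar
      · simp [hj]
      · have hc : ContinuousAt (fun s : ℝ => (1 + s) * v jstar) 0 := by fun_prop
        filter_upwards [hc.eventually_const_lt (by simpa using hgt j hj)] with s hs _ using hs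
    filter_upwards [hs1, hdomin] with s hs hd
    have hup : 0 < (1 + s) * v jstar := mul_pos hs h0
    have h := hcmp p (Function.update v jstar ((1 + s) * v jstar)) hp0 (fun j => ?_) hqp
      (fun ω hω => ?_)
    · rw [expertLogLik_update (fun k _ => hge k) hs h0 fun k hk => (hd k hk).le, ← hAcc,
        sum_update_one_add_mul] at h
      rw [show 1 + s * v jstar = ∑ i, p i + (∑ j, v j + s * v jstar) by linarith]
      linarith
    · rw [Function.update_apply]
      split_ifs
      · exact hup.le
      · exact hv0 j
    · have h := maxOrOne_update (fun k _ => hge k) (fun k hk => (hd k hk).le)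
        (correctExperts Y M ω)
      by_cases hc : jstar ∈ correctExperts Y M ω
      · rw [(h.1 hc).1]
        exact hup
      · rw [h.2 hc]
        exact hqv ω hω
  refine ⟨fun y => by rw [ep, hclass], fun j hj => by rw [ev, ev]; exact hgt j hj,
    by rw [ev, hstar], fun hA c hc => ?_, fun ⟨y, hy⟩ c hc => ?_⟩
  · rcases c with y | j
    · rw [ep, ev, hclass, hstar]
      exact div_lt_div_of_pos_right (hA y) hV0
    · rw [ev, ev]
      exact hgt j fun e => hc (by rw [e])
  · rcases c with y' | j
    · refine ⟨y', rfl, fun y'' => ?_⟩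
      have h := hc (Sum.inl y'')
      rw [ep, ep, hclass, hclass, div_le_div_iff_of_pos_right hV0] at h
      exact h
    · have h := hc (Sum.inl y)
      rw [ep, ev, hclass] at h
      have h2 := (h.trans (hge j))
      rw [hstar, div_le_div_iff_of_pos_right hV0] at h2
      linarith
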